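/- arXiv:2305.10728 — 2 statements merged into one kernel-verified Lean document; each statement's English description precedes it below -/
import Mathlib

section
/- Let n ≥ 2 and let u ∈ ℝⁿ be the all-ones vector, z ∈ ℝⁿ a vector with entries in {0,1}, and w ∈ ℝⁿ an arbitrary vector. Suppose there exist indices a ≠ b such that z_a = z_b = 0, w_a ≠ 0, and w_a ≠ w_b, and suppose there exists an index k with z_k = 1. Then the three vectors u, z, w are linearly independent; equivalently, the Gram matrix XᵀX of the n × 3 matrix X = [u z w] is nonsingular. -/
open Matrix

/-- The Gram matrix of a finite linearly independent family of real vectors is nonsingular. -/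
theorem det_transpose_mul_self_ne_zero_of_linearIndependent
    {m ι : Type*} [Fintype m] [Fintype ι] [DecidableEq ι] {v : ι → m → ℝ}
    (hv : LinearIndependent ℝ v) :
    ((Matrix.of fun i j => v j i)ᵀ * (Matrix.of fun i j => v j i)).det ≠ 0 := by
  have hinj : Function.Injective (Matrix.of fun i j => v j i).mulVec :=
    Matrix.mulVec_injective_iff.mpr hv
  have hpos := Matrix.PosDef.conjTranspose_mul_self _ hinj
  rw [Matrix.conjTranspose_eq_transpose_of_trivial] at hpos
  exact hpos.det_pos.ne'

/-- **Proposition 1** (identification with a single interference term), linear-algebraic form.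
`u` is the all-ones column, `z` the binary treatment column, `w` the interference-exposure
column. Two untreated observations with distinct exposures, one nonzero, plus one treated
observation, force the three columns to be linearly independent; equivalently the Gram
matrix `XᵀX` of `X = [u z w]` is nonsingular. -/
theorem single_interference_identification
    {n : ℕ} (hn : 2 ≤ n) (u z w : Fin n → ℝ)
    (hu : ∀ i, u i = 1) (hz : ∀ i, z i = 0 ∨ z i = 1)
    (a b : Fin n) (hab : a ≠ b) (hza : z a = 0) (hzb : z b = 0)
    (hwa : w a ≠ 0) (hwab : w a ≠ w b)
    (k : Fin n) (hzk : z k = 1) :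
    LinearIndependent ℝ ![u, z, w] ∧
      ((Matrix.of fun (i : Fin n) (j : Fin 3) => ![u, z, w] j i)ᵀ *
        (Matrix.of fun (i : Fin n) (j : Fin 3) => ![u, z, w] j i)).det ≠ 0 := by
  have hli : LinearIndependent ℝ ![u, z, w] := by
    rw [Fintype.linearIndependent_iff]
    intro g hg
    have hrow : ∀ i, g 0 + g 1 * z i + g 2 * w i = 0 := fun i => by
      simpa [Fin.sum_univ_three, hu] using congrFun hg i
    have ha := hrow a
    have hb := hrow b
    have hk := hrow k
    rw [hza] at ha
    rw [hzb] at hb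
    rw [hzk] at hk
    have h2 : g 2 = 0 :=
      (mul_eq_zero.mp (show g 2 * (w a - w b) = 0 by linarith)).resolve_right
        (sub_ne_zero.mpr hwab)
    rw [h2] at ha hk
    have h0 : g 0 = 0 := by linarith
    have h1 : g 1 = 0 := by linarith
    intro i
    fin_cases i
    exacts [h0, h1, h2]
  exact ⟨hli, det_transpose_mul_self_ne_zero_of_linearIndependent hli⟩
end

section
/- Let G be a simple undirected graph on vertex set {1,…,N} (so j is a neighbor of i if and only if i is a neighbor of j), and let Z¹,…,Z^T ∈ {0,1}^N be treatment vectors of a roll-out, i.e., monotone in time: Z^{t-1}_i = 1 implies Z^t_i = 1 for all i and all t. For each unit i and period t define the exposure f_i(Zᵗ) = Σ_{j ∈ G(i)} Zᵗ_j, the number of treated neighbors of i at time t. Let X ∈ ℝ^{NT×3} be the matrix whose row for unit–period (i,t) is (1, Zᵗ_i, f_i(Zᵗ)). Suppose there exist a period t > 1 and units i, j with j a neighbor of i, such that Z¹_j = 0, Zᵗ_j = 1, and Zᵗ_i = 0. Then XᵀX is nonsingular. -/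
open Matrix

/-- The Gram matrix of a real matrix with trivial kernel is nonsingular. -/
theorem Matrix.det_transpose_mul_self_ne_zero {m n : Type*} [Fintype m] [Fintype n]
    [DecidableEq n] (A : Matrix m n ℝ) (hA : ∀ v, A *ᵥ v = 0 → v = 0) :
    (Aᵀ * A).det ≠ 0 := by
  intro hdet
  obtain ⟨v, hv, hAv⟩ := Matrix.exists_mulVec_eq_zero_iff.mpr hdet
  rw [← Matrix.conjTranspose_eq_transpose_of_trivial,
    Matrix.conjTranspose_mul_self_mulVec_eq_zero] at hAv
  exact hv (hA v hAv)

/-- **Corollary 1** (identification for linear-in-sums neighborhood interference under a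
roll-out). Periods are indexed by `Fin T` (index `⟨0, hT⟩` is the first period `t = 1`).
`Z t i ∈ {0,1}` is the treatment status of unit `i` at period `t`, monotone in `t`
(roll-out). The exposure of unit `i` at period `t` is `∑ k ∈ G.neighborFinset i, Z t k`,
the number of treated neighbors. If at some period `t` after the first there is a newly
treated unit `j` (untreated at the first period) with an untreated neighbor `i`, then the
Gram matrix `XᵀX` of the `NT × 3` design matrix with rows `(1, Zᵗ_i, f_i(Zᵗ))` is
nonsingular. -/
theorem rollout_neighborhood_identification
    {N T : ℕ} (hT : 0 < T) (G : SimpleGraph (Fin N)) [DecidableRel G.Adj]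
    (Z : Fin T → Fin N → ℝ) (hZ01 : ∀ t i, Z t i = 0 ∨ Z t i = 1)
    (hmono : ∀ s t : Fin T, s ≤ t → ∀ i, Z s i = 1 → Z t i = 1)
    (t : Fin T) (ht : (⟨0, hT⟩ : Fin T) < t)
    (i j : Fin N) (hadj : G.Adj i j)
    (hj1 : Z ⟨0, hT⟩ j = 0) (hjt : Z t j = 1) (hit : Z t i = 0) :
    ((Matrix.of fun (p : Fin N × Fin T) (c : Fin 3) =>
        ![1, Z p.2 p.1, ∑ k ∈ G.neighborFinset p.1, Z p.2 k] c)ᵀ *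
      (Matrix.of fun (p : Fin N × Fin T) (c : Fin 3) =>
        ![1, Z p.2 p.1, ∑ k ∈ G.neighborFinset p.1, Z p.2 k] c)).det ≠ 0 := by
  have hle : ∀ k, Z ⟨0, hT⟩ k ≤ Z t k := by
    intro k
    rcases hZ01 ⟨0, hT⟩ k with h | h
    · rcases hZ01 t k with h' | h' <;> simp [h, h']
    · rw [h, hmono _ _ ht.le k h]
  have hi1 : Z ⟨0, hT⟩ i = 0 := by
    rcases hZ01 ⟨0, hT⟩ i with h | h
    · exact h
    · linarith [hle i]
  have hlt : ∑ k ∈ G.neighborFinset i, Z ⟨0, hT⟩ k < ∑ k ∈ G.neighborFinset i, Z t k :=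
    Finset.sum_lt_sum (fun k _ => hle k)
      ⟨j, (G.mem_neighborFinset i j).mpr hadj, by rw [hj1, hjt]; exact one_pos⟩
  refine Matrix.det_transpose_mul_self_ne_zero _ fun v hv => ?_
  have row_i_first := congrFun hv (i, ⟨0, hT⟩)
  have row_i := congrFun hv (i, t)
  have row_j := congrFun hv (j, t)
  simp only [Matrix.mulVec, dotProduct, Matrix.of_apply, Fin.sum_univ_three, Matrix.cons_val,
    Pi.zero_apply, hi1, hit, hjt, one_mul, zero_mul, add_zero] at row_i_first row_i row_j
  have hv2 : v 2 = 0 := by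
    have hprod : (∑ k ∈ G.neighborFinset i, Z t k -
        ∑ k ∈ G.neighborFinset i, Z ⟨0, hT⟩ k) * v 2 = 0 := by linarith
    exact (mul_eq_zero.mp hprod).resolve_left (sub_pos.mpr hlt).ne'
  rw [hv2, mul_zero, add_zero] at row_i row_j
  rw [row_i, zero_add] at row_j
  ext c
  fin_cases c
  exacts [row_i, row_j, hv2]
end
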